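/- arXiv:2402.02673 — 2 statements merged into one kernel-verified Lean document; each statement's English description precedes it below -/
import Mathlib

section
/- Let t ≥ 2, let γ⃗ be a rational family of position score functions for β = ℓ_1, and let v⃗ = (k_1, …, k_{t−1}, k_t) be any stage vector with k_1 > … > k_t ≥ 1 and k_t = k_{t−1} − 1. Then there exist an election E = (C,V) with |C| = k_1 + 1 candidates, a candidate c ∈ C belonging to some committee in the t-stage (ℓ_1, γ⃗)-rule's output 𝓡(E, v⃗), and a voter such that, after shifting c one position forward in that voter's preference list to obtain E', the candidate c belongs to no committee in 𝓡(E', v⃗). -/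
/-- Position (1-indexed) of candidate `c` in voter `v`'s induced ranking on the
pool `C` (voters are ranking functions, smaller value = more preferred). -/
def posIn {α : Type} (v : α → ℕ) (C : Finset α) (c : α) : ℕ :=
  (C.filter fun c' => v c' ≤ v c).card

/-- Every voter of `V` has a strict (injective) preference on the candidate set `C`. -/
def StrictPrefs {α : Type} (C : Finset α) (V : List (α → ℕ)) : Prop :=
  ∀ v ∈ V, Set.InjOn v ↑C

/-- The two norms parameterizing score-based rules. -/
inductive ScoreNorm : Type
  | l1
  | lmax

/-- Voter `v`'s score for a committee `S` on the pool `C` with target size `k`,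
under the `(β, γ)`-rule (`γ m k p` is the position score of position `p` for
`m` candidates and target size `k`). -/
noncomputable def voterScore {α : Type} (β : ScoreNorm) (γ : ℕ → ℕ → ℕ → ℝ)
    (C : Finset α) (k : ℕ) (v : α → ℕ) (S : Finset α) : ℝ :=
  match β with
  | .l1 => ∑ c ∈ S, γ C.card k (posIn v C c)
  | .lmax => sSup ((fun c => γ C.card k (posIn v C c)) '' (S : Set α))

/-- Total score `Σ_{v ∈ V} f_v(S)` of a committee. -/
noncomputable def totalScore {α : Type} (β : ScoreNorm) (γ : ℕ → ℕ → ℕ → ℝ)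
    (C : Finset α) (V : List (α → ℕ)) (k : ℕ) (S : Finset α) : ℝ :=
  (V.map fun v => voterScore β γ C k v S).sum

/-- Winning committees of the single-stage `(β, γ)`-rule: the size-`k` committees
maximizing the total score. -/
def scoreWinners {α : Type} (β : ScoreNorm) (γ : ℕ → ℕ → ℕ → ℝ)
    (C : Finset α) (V : List (α → ℕ)) (k : ℕ) : Set (Finset α) :=
  {S | S ⊆ C ∧ S.card = k ∧
    ∀ T ⊆ C, T.card = k → totalScore β γ C V k T ≤ totalScore β γ C V k S}

/-- Winning committees of the multi-stage `(β, γ)`-rule for stage vector `ks`: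
the winning committee of each stage is the candidate pool of the next stage. -/
def msWinners {α : Type} (β : ScoreNorm) (γ : ℕ → ℕ → ℕ → ℝ) :
    List ℕ → Finset α → List (α → ℕ) → Set (Finset α)
  | [], C, _ => {C}
  | k :: ks, C, V => {S | ∃ S₁ ∈ scoreWinners β γ C V k, S ∈ msWinners β γ ks S₁ V}

/-- Each `γ^{m,k}` is non-increasing on the positions `1, …, m`. -/
def GammaMono (γ : ℕ → ℕ → ℕ → ℝ) : Prop :=
  ∀ m k p q : ℕ, 1 ≤ p → p ≤ q → q ≤ m → γ m k q ≤ γ m k p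

/-- Rationality of a `(β, γ)`-rule: for every pair `(m, k)` with `m > k ≥ 1`,
`γ^{m,k}(1) > γ^{m,k}(m)` when `β = ℓ₁`, and `γ^{m,k}(1) > γ^{m,k}(m-k+1)` when
`β = ℓ_max`. -/
def RationalRule : ScoreNorm → (ℕ → ℕ → ℕ → ℝ) → Prop
  | .l1, γ => ∀ m k : ℕ, 1 ≤ k → k < m → γ m k m < γ m k 1
  | .lmax, γ => ∀ m k : ℕ, 1 ≤ k → k < m → γ m k (m - k + 1) < γ m k 1

/-- A valid stage vector for the candidate set `C`: `|C| > k_1 > … > k_t ≥ 1`. -/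
def ValidVec {α : Type} (C : Finset α) (ks : List ℕ) : Prop :=
  List.Chain (· > ·) C.card ks ∧ ∀ k ∈ ks, 1 ≤ k

/-- The preference list obtained from `v` by swapping the positions of `c` and
`d`; when `d` is the candidate ranked directly above `c`, this shifts `c` one
position forward. -/
def shiftForward {α : Type} [DecidableEq α] (v : α → ℕ) (c d : α) : α → ℕ :=
  fun x => if x = c then v d else if x = d then v c else v x

section MonotonicityCounterexample

open Finset Equiv

/-- Total position score of a single candidate `e` in the pool `C`. -/
noncomputable def candScore {α : Type} (γ : ℕ → ℕ → ℕ → ℝ) (C : Finset α) (V : List (α → ℕ))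
    (k : ℕ) (e : α) : ℝ :=
  (V.map fun v => γ C.card k (posIn v C e)).sum

lemma totalScore_l1 {α : Type} (γ : ℕ → ℕ → ℕ → ℝ) (C : Finset α) (V : List (α → ℕ))
    (k : ℕ) (S : Finset α) :
    totalScore ScoreNorm.l1 γ C V k S = ∑ e ∈ S, candScore γ C V k e := by
  induction V with
  | nil => simp [totalScore, candScore]
  | cons v V ih =>
    simp only [totalScore, candScore, List.map_cons, List.sum_cons, Finset.sum_add_distrib] at ih ⊢
    rw [ih]
    rfl

lemma mem_scoreWinners_of_tied {α : Type} {γ : ℕ → ℕ → ℕ → ℝ} {C : Finset α}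
    {V : List (α → ℕ)} {k : ℕ} {x : ℝ} (h : ∀ e ∈ C, candScore γ C V k e = x)
    {S : Finset α} (hS : S ⊆ C) (hk : S.card = k) :
    S ∈ scoreWinners ScoreNorm.l1 γ C V k := by
  refine ⟨hS, hk, fun T hT hTk => ?_⟩
  rw [totalScore_l1, totalScore_l1, Finset.sum_congr rfl fun e he => h e (hT he),
    Finset.sum_congr rfl fun e he => h e (hS he)]
  simp [hk, hTk]

lemma singleton_mem_scoreWinners {α : Type} {γ : ℕ → ℕ → ℕ → ℝ} {C : Finset α}
    {V : List (α → ℕ)} {c : α} (hc : c ∈ C)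
    (h : ∀ e ∈ C, candScore γ C V 1 e ≤ candScore γ C V 1 c) :
    {c} ∈ scoreWinners ScoreNorm.l1 γ C V 1 := by
  refine ⟨by simpa using hc, by simp, fun T hT hTk => ?_⟩
  obtain ⟨e, rfl⟩ := Finset.card_eq_one.mp hTk
  simpa [totalScore_l1] using h e (hT (by simp))

/-- A candidate with strictly the smallest score is in no winning committee. -/
lemma notMem_of_unique_worst {α : Type} [DecidableEq α] {γ : ℕ → ℕ → ℕ → ℝ} {C : Finset α}
    {V : List (α → ℕ)} {k : ℕ} {w : α} (hk : k < C.card)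
    (h : ∀ e ∈ C, e ≠ w → candScore γ C V k w < candScore γ C V k e)
    {S : Finset α} (hS : S ∈ scoreWinners ScoreNorm.l1 γ C V k) : w ∉ S := by
  intro hw
  obtain ⟨hSC, hSk, hmax⟩ := hS
  obtain ⟨e, heC, heS⟩ := Finset.exists_mem_notMem_of_card_lt_card (hSk ▸ hk)
  have hne : e ≠ w := fun h => heS (h ▸ hw)
  have heS' : e ∉ S.erase w := fun h => heS (Finset.mem_of_mem_erase h)
  have hcard : (insert e (S.erase w)).card = k := by
    rw [Finset.card_insert_of_notMem heS', Finset.card_erase_add_one hw, hSk]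
  have hsub : insert e (S.erase w) ⊆ C :=
    Finset.insert_subset heC ((Finset.erase_subset _ _).trans hSC)
  have := hmax _ hsub hcard
  rw [totalScore_l1, totalScore_l1, Finset.sum_insert heS', ← Finset.add_sum_erase S _ hw] at this
  linarith [h e heC hne]

lemma subset_of_mem_msWinners {α : Type} {β : ScoreNorm} {γ : ℕ → ℕ → ℕ → ℝ}
    {V : List (α → ℕ)} (ks : List ℕ) {C S : Finset α} (h : S ∈ msWinners β γ ks C V) :
    S ⊆ C := by
  induction ks generalizing C with
  | nil => exact (Set.mem_singleton_iff.mp h).subset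
  | cons k ks ih =>
    obtain ⟨S₁, h₁, h₂⟩ := h
    exact (ih h₂).trans h₁.1

/-- Sum of `f` over the positions of `e` in the pool `S` for the voters in `F`. -/
noncomputable def permScore (F : Finset (Perm ℕ)) (f : ℕ → ℝ) (S : Finset ℕ) (e : ℕ) : ℝ :=
  ∑ σ ∈ F, f (posIn σ S e)

lemma posIn_mul {S : Finset ℕ} {τ : Perm ℕ} (hS : ∀ x, τ x ∈ S ↔ x ∈ S) (σ : Perm ℕ) (e : ℕ) :
    posIn (σ * τ : Perm ℕ) S e = posIn σ S (τ e) := by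
  refine Finset.card_equiv τ fun x => ?_
  rw [mem_filter, mem_filter, hS]
  rfl

/-- Renaming candidates by a permutation fixing the pool. -/
lemma permScore_relabel {F G : Finset (Perm ℕ)} {S : Finset ℕ} {τ : Perm ℕ}
    (hS : ∀ x, τ x ∈ S ↔ x ∈ S) (hFG : ∀ σ, σ ∈ F ↔ σ * τ ∈ G) (f : ℕ → ℝ) (e : ℕ) :
    permScore F f S (τ e) = permScore G f S e := by
  refine Finset.sum_equiv (Equiv.mulRight τ) hFG fun σ _ => ?_
  rw [Equiv.coe_mulRight, posIn_mul hS]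

lemma swap_apply_mem_iff {S : Finset ℕ} {a b : ℕ} (h : a ∈ S ↔ b ∈ S) (x : ℕ) :
    swap a b x ∈ S ↔ x ∈ S := by
  rw [swap_apply_def]
  split_ifs <;> simp_all

/-- The permutations of `{0, …, m - 1}`; such a permutation maps candidates to ranks. -/
def allPerms (m : ℕ) : Finset (Perm ℕ) := permsOfFinset (range m)

lemma mem_allPerms {m : ℕ} {σ : Perm ℕ} : σ ∈ allPerms m ↔ ∀ x, σ x ≠ x → x < m := by
  simp [allPerms, mem_perms_of_finset_iff]

lemma apply_lt_iff {m : ℕ} {σ : Perm ℕ} (h : σ ∈ allPerms m) (x : ℕ) : σ x < m ↔ x < m := by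
  rw [mem_allPerms] at h
  by_cases hx : σ x = x
  · rw [hx]
  · exact ⟨fun _ => h x hx, fun _ => h (σ x) fun h' => hx (σ.injective h')⟩

lemma mul_mem_allPerms {m : ℕ} {σ τ : Perm ℕ} (hσ : σ ∈ allPerms m) (hτ : τ ∈ allPerms m) :
    σ * τ ∈ allPerms m := by
  rw [mem_allPerms] at *
  intro x hx
  by_cases h : τ x = x
  · exact hσ x (by simpa [h] using hx)
  · exact hτ x h

lemma swap_mem_allPerms {m a b : ℕ} (ha : a < m) (hb : b < m) : swap a b ∈ allPerms m := by
  rw [mem_allPerms]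
  intro x hx
  by_contra h
  exact hx (swap_apply_of_ne_of_ne (by omega) (by omega))

lemma mem_allPerms_iff_mul_swap {m a b : ℕ} (ha : a < m) (hb : b < m) (σ : Perm ℕ) :
    σ ∈ allPerms m ↔ σ * swap a b ∈ allPerms m := by
  refine ⟨fun h => mul_mem_allPerms h (swap_mem_allPerms ha hb), fun h => ?_⟩
  simpa [mul_assoc] using mul_mem_allPerms h (swap_mem_allPerms ha hb)

/-- A permutation can be modified to send `a` to `t`, keeping the values other than `t`
at the points other than `a`. -/
lemma exists_redirect {m : ℕ} {σ : Perm ℕ} (hσ : σ ∈ allPerms m) {a t : ℕ} (ha : a < m)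
    (ht : t < m) : ∃ ρ ∈ allPerms m, ρ a = t ∧ ∀ b, b ≠ a → σ b ≠ t → ρ b = σ b := by
  refine ⟨swap (σ a) t * σ,
    mul_mem_allPerms (swap_mem_allPerms ((apply_lt_iff hσ a).2 ha) ht) hσ, by simp, ?_⟩
  intro b hb hbt
  exact swap_apply_of_ne_of_ne (fun h => hb (σ.injective h)) hbt

lemma exists_perm_three {m a b c ra rb rc : ℕ} (ha : a < m) (hb : b < m) (hc : c < m)
    (hra : ra < m) (hrb : rb < m) (hrc : rc < m) (hab : a ≠ b) (hac : a ≠ c) (hbc : b ≠ c)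
    (hrab : ra ≠ rb) (hrac : ra ≠ rc) (hrbc : rb ≠ rc) :
    ∃ σ ∈ allPerms m, σ a = ra ∧ σ b = rb ∧ σ c = rc := by
  obtain ⟨σ₁, h₁, ha₁, -⟩ :=
    exists_redirect (σ := 1) (mem_allPerms.2 fun x hx => absurd rfl hx) ha hra
  obtain ⟨σ₂, h₂, hb₂, hr₂⟩ := exists_redirect h₁ hb hrb
  obtain ⟨σ₃, h₃, hc₃, hr₃⟩ := exists_redirect h₂ hc hrc
  have ha₂ : σ₂ a = ra := by rw [hr₂ a hab (by rwa [ha₁]), ha₁]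
  exact ⟨σ₃, h₃, by rw [hr₃ a hac (by rwa [ha₂]), ha₂], by rw [hr₃ b hbc (by rwa [hb₂]), hb₂], hc₃⟩

lemma posIn_range {m : ℕ} {σ : Perm ℕ} (h : σ ∈ allPerms m) {e : ℕ} (he : e < m) :
    posIn σ (range m) e = σ e + 1 := by
  rw [← Finset.card_range (σ e + 1)]
  refine Finset.card_equiv σ fun x => ?_
  have h₁ := apply_lt_iff h x
  have h₂ := (apply_lt_iff h e).2 he
  simp only [mem_filter, mem_range]
  omega

lemma posIn_erase {v : ℕ → ℕ} {S : Finset ℕ} {d e : ℕ} (hd : d ∈ S) :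
    posIn v (S.erase d) e + (if v d ≤ v e then 1 else 0) = posIn v S e := by
  unfold posIn
  rw [Finset.filter_erase]
  split_ifs with h
  · exact Finset.card_erase_add_one (by simp [hd, h])
  · rw [Finset.erase_eq_of_notMem (by simp [h]), add_zero]

/-- The candidates `0`, `1`, `2` are ranked in this cyclic order. -/
def IsCyclicTriple (σ : Perm ℕ) : Prop :=
  (σ 0 < σ 1 ∧ σ 1 < σ 2) ∨ (σ 1 < σ 2 ∧ σ 2 < σ 0) ∨ (σ 2 < σ 0 ∧ σ 0 < σ 1)

instance : DecidablePred IsCyclicTriple := fun σ => by unfold IsCyclicTriple; infer_instance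

/-- The permutations ranking `0`, `1`, `2` in this cyclic order. -/
def cycPerms (m : ℕ) : Finset (Perm ℕ) := (allPerms m).filter IsCyclicTriple

/-- The permutations ranking `0`, `1`, `2` in the opposite cyclic order. -/
def anticycPerms (m : ℕ) : Finset (Perm ℕ) := (allPerms m).filter fun σ => ¬ IsCyclicTriple σ

lemma permScore_cyc_add_anticyc (m : ℕ) (f : ℕ → ℝ) (S : Finset ℕ) (e : ℕ) :
    permScore (cycPerms m) f S e + permScore (anticycPerms m) f S e =
      permScore (allPerms m) f S e :=
  Finset.sum_filter_add_sum_filter_not _ _ _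

lemma isCyclicTriple_mul_swap (σ : Perm ℕ) {a b : ℕ} (ha : a < 3) (hb : b < 3) (hab : a ≠ b) :
    IsCyclicTriple (σ * swap a b) ↔ ¬ IsCyclicTriple σ := by
  have h01 : σ 0 ≠ σ 1 := σ.injective.ne (by decide)
  have h02 : σ 0 ≠ σ 2 := σ.injective.ne (by decide)
  have h12 : σ 1 ≠ σ 2 := σ.injective.ne (by decide)
  interval_cases a <;> interval_cases b <;>
    simp [IsCyclicTriple, swap_apply_def] at hab ⊢ <;> omega

lemma mem_cycPerms_iff_mul_swap {m a b : ℕ} (hm : 3 ≤ m) (ha : a < 3) (hb : b < 3) (hab : a ≠ b)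
    (σ : Perm ℕ) : σ ∈ cycPerms m ↔ σ * swap a b ∈ anticycPerms m := by
  rw [cycPerms, anticycPerms, mem_filter, mem_filter, isCyclicTriple_mul_swap σ ha hb hab, not_not,
    ← mem_allPerms_iff_mul_swap (by omega) (by omega)]

lemma permScore_cyc_swap {m a b : ℕ} (hm : 3 ≤ m) (ha : a < 3) (hb : b < 3) (hab : a ≠ b)
    {S : Finset ℕ} (hS : a ∈ S ↔ b ∈ S) (f : ℕ → ℝ) (e : ℕ) :
    permScore (cycPerms m) f S (swap a b e) = permScore (anticycPerms m) f S e :=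
  permScore_relabel (swap_apply_mem_iff hS) (mem_cycPerms_iff_mul_swap hm ha hb hab) f e

lemma permScore_allPerms_eq {m : ℕ} {S : Finset ℕ} (hS : S ⊆ range m) (f : ℕ → ℝ) {a b : ℕ}
    (ha : a ∈ S) (hb : b ∈ S) :
    permScore (allPerms m) f S a = permScore (allPerms m) f S b := by
  have := permScore_relabel (swap_apply_mem_iff (iff_of_true ha hb))
    (mem_allPerms_iff_mul_swap (mem_range.1 (hS ha)) (mem_range.1 (hS hb))) f b
  rwa [swap_apply_right] at this

/-- In a pool containing `0`, `1`, `2`, the cyclic profile gives all candidates the same score. -/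
lemma permScore_cyc_tied {m : ℕ} (hm : 3 ≤ m) {S : Finset ℕ} (hS : S ⊆ range m)
    (h0 : 0 ∈ S) (h1 : 1 ∈ S) (h2 : 2 ∈ S) (f : ℕ → ℝ) {e : ℕ} (he : e ∈ S) :
    permScore (cycPerms m) f S e = permScore (allPerms m) f S 0 / 2 := by
  have key : permScore (cycPerms m) f S e = permScore (anticycPerms m) f S e := by
    have s01 := permScore_cyc_swap hm (a := 0) (b := 1) (by omega) (by omega) (by omega)
      (iff_of_true h0 h1) f
    have s12 := permScore_cyc_swap hm (a := 1) (b := 2) (by omega) (by omega) (by omega)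
      (iff_of_true h1 h2) f
    have s02 := permScore_cyc_swap hm (a := 0) (b := 2) (by omega) (by omega) (by omega)
      (iff_of_true h0 h2) f
    by_cases hlt : e < 3
    · have a0 := s01 0
      have a1 := s01 1
      have a2 := s12 1
      have a3 := s12 2
      have a4 := s02 0
      have a5 := s02 2
      simp only [swap_apply_left, swap_apply_right] at a0 a1 a2 a3 a4 a5
      interval_cases e <;> linarith
    · rw [← s01 e, swap_apply_of_ne_of_ne (by omega) (by omega)]
  linarith [permScore_cyc_add_anticyc m f S e, permScore_allPerms_eq hS f he h0]

/-- The anticyclic score of candidate `0` as a sum over the cyclic profile. -/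
lemma permScore_anticyc_zero {m : ℕ} (hm : 3 ≤ m) (f : ℕ → ℝ) (S : Finset ℕ) :
    permScore (anticycPerms m) f S 0 =
      ∑ σ ∈ cycPerms m, f (posIn (σ * swap 1 2 : Perm ℕ) S 0) := by
  symm
  exact Finset.sum_equiv (Equiv.mulRight (swap 1 2))
    (mem_cycPerms_iff_mul_swap hm (by omega) (by omega) (by omega)) fun σ _ => rfl

lemma permScore_cyc_pair {m : ℕ} (hm : 3 ≤ m) (f : ℕ → ℝ) (hf : f 2 ≤ f 1) :
    permScore (cycPerms m) f {0, 1} 1 ≤ permScore (cycPerms m) f {0, 1} 0 := by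
  have h := permScore_cyc_swap hm (a := 0) (b := 1) (by omega) (by omega) (by omega)
      (S := {0, 1}) (by simp) f 0
  rw [swap_apply_left] at h
  rw [h, permScore_anticyc_zero hm]
  refine Finset.sum_le_sum fun σ hσ => ?_
  have hpos : ∀ ρ : Perm ℕ, posIn ρ {0, 1} 0 = 1 + if ρ 1 ≤ ρ 0 then 1 else 0 := by
    intro ρ
    unfold posIn
    rw [Finset.filter_insert, Finset.filter_singleton]
    split_ifs <;> simp_all
  have hcyc := (mem_filter.1 hσ).2
  have e0 : (σ * swap 1 2 : Perm ℕ) 0 = σ 0 := by simp [swap_apply_def]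
  have e1 : (σ * swap 1 2 : Perm ℕ) 1 = σ 2 := by simp
  rw [hpos, hpos, e0, e1]
  unfold IsCyclicTriple at hcyc
  split_ifs
  · exact le_rfl
  · exact hf
  · omega
  · exact le_rfl

/-- A function that is larger at `1` than at `n` drops strictly at some step. -/
lemma exists_strict_drop {f : ℕ → ℝ} {n : ℕ} (hn : 1 ≤ n) (h : f n < f 1) :
    ∃ p, 1 ≤ p ∧ p < n ∧ f (p + 1) < f p := by
  by_contra! hcon
  have : ∀ q, 1 ≤ q → q ≤ n → f 1 ≤ f q := by
    intro q hq
    induction q, hq using Nat.le_induction with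
    | base => exact fun _ => le_rfl
    | succ q hq ih => exact fun hqn => (ih (by omega)).trans (hcon q hq (by omega))
  exact absurd (this n hn le_rfl) (not_le.2 h)

lemma permScore_cyc_lt_anticyc {m : ℕ} (hm : 3 ≤ m) {f : ℕ → ℝ}
    (hmono : ∀ p, 1 ≤ p → p + 1 ≤ m - 1 → f (p + 1) ≤ f p) (hlt : f (m - 1) < f 1) :
    permScore (cycPerms m) f ((range m).erase 1) 0 <
      permScore (anticycPerms m) f ((range m).erase 1) 0 := by
  rw [permScore_anticyc_zero hm]
  have hm1 : 1 ∈ range m := by simp; omega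
  have hpos : ∀ ρ ∈ allPerms m, posIn ρ ((range m).erase 1) 0 =
      ρ 0 + 1 - if ρ 1 ≤ ρ 0 then 1 else 0 := by
    intro ρ hρ
    have := posIn_erase (v := ρ) (e := 0) hm1
    rw [posIn_range hρ (by omega)] at this
    omega
  have hpos' : ∀ σ ∈ cycPerms m, posIn (σ * swap 1 2 : Perm ℕ) ((range m).erase 1) 0 =
      σ 0 + 1 - if σ 2 ≤ σ 0 then 1 else 0 := by
    intro σ hσ
    rw [hpos _ ((mem_allPerms_iff_mul_swap (by omega) (by omega) σ).1 (mem_filter.1 hσ).1)]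
    simp [swap_apply_def]
  refine Finset.sum_lt_sum (fun σ hσ => ?_) ?_
  · rw [hpos σ (mem_filter.1 hσ).1, hpos' σ hσ]
    have hcyc := (mem_filter.1 hσ).2
    have h1 := (apply_lt_iff (mem_filter.1 hσ).1 1).2 (by omega)
    unfold IsCyclicTriple at hcyc
    split_ifs
    · exact le_rfl
    · omega
    · exact hmono _ (by omega) (by omega)
    · exact le_rfl
  · obtain ⟨p, hp1, hpm, hp⟩ := exists_strict_drop (by omega) hlt
    obtain ⟨σ, hσ, h0, h1, h2⟩ := exists_perm_three (m := m) (a := 0) (b := 1) (c := 2)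
      (ra := p) (rb := p + 1) (rc := p - 1) (by omega) (by omega) (by omega) (by omega)
      (by omega) (by omega) (by omega) (by omega) (by omega) (by omega) (by omega) (by omega)
    have hσc : σ ∈ cycPerms m := mem_filter.2 ⟨hσ, by unfold IsCyclicTriple; omega⟩
    refine ⟨σ, hσc, ?_⟩
    rw [hpos σ hσ, hpos' σ hσc, h0, h1, h2, if_neg (by omega), if_pos (by omega)]
    exact hp

/-- Candidate `0` is strictly the worst candidate once candidate `1` has been removed. -/
lemma permScore_cyc_unique_worst {m : ℕ} (hm : 3 ≤ m) {f : ℕ → ℝ}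
    (hmono : ∀ p, 1 ≤ p → p + 1 ≤ m - 1 → f (p + 1) ≤ f p) (hlt : f (m - 1) < f 1)
    {e : ℕ} (he : e ∈ (range m).erase 1) (he0 : e ≠ 0) :
    permScore (cycPerms m) f ((range m).erase 1) 0 <
      permScore (cycPerms m) f ((range m).erase 1) e := by
  have h0 : 0 ∈ (range m).erase 1 := by simp; omega
  have h2 : 2 ∈ (range m).erase 1 := by simp; omega
  have hlt' := permScore_cyc_lt_anticyc hm hmono hlt
  have s02 := permScore_cyc_swap hm (a := 0) (b := 2) (by omega) (by omega) (by omega)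
      (iff_of_true h0 h2) f
  by_cases he2 : e = 2
  · rwa [he2, ← swap_apply_left 0 2, s02 0]
  · have := s02 e
    rw [swap_apply_of_ne_of_ne he0 he2] at this
    linarith [permScore_cyc_add_anticyc m f ((range m).erase 1) e,
      permScore_cyc_add_anticyc m f ((range m).erase 1) 0,
      permScore_allPerms_eq (Finset.erase_subset 1 (range m)) f he h0]

open Classical in
/-- The voters other than `σ₀`: all other permutations, and all cyclic ones a second time. -/
noncomputable def otherVoters (m : ℕ) (σ₀ : Perm ℕ) : List (ℕ → ℕ) :=
  (((allPerms m).erase σ₀).toList ++ (cycPerms m).toList).map fun σ : Perm ℕ => ⇑σ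

open Classical in
lemma candScore_profile {m : ℕ} {σ₀ : Perm ℕ} (hσ₀ : σ₀ ∈ allPerms m) (γ : ℕ → ℕ → ℕ → ℝ)
    (S : Finset ℕ) (k e : ℕ) :
    candScore γ S (σ₀ :: otherVoters m σ₀) k e =
      permScore (allPerms m) (γ S.card k) S e + permScore (cycPerms m) (γ S.card k) S e := by
  have h (F : Finset (Perm ℕ)) : (F.toList.map fun σ : Perm ℕ => γ S.card k (posIn σ S e)).sum =
      permScore F (γ S.card k) S e := Finset.sum_map_toList _ _
  have h' := Finset.add_sum_erase (allPerms m) (fun σ : Perm ℕ => γ S.card k (posIn σ S e)) hσ₀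
  simp only [candScore, otherVoters, List.map_cons, List.sum_cons, List.map_map, List.map_append,
    List.sum_append, Function.comp_def, h]
  rw [← add_assoc]
  congr 1

/-- Candidate `0` can survive all stages of the cyclic profile. -/
lemma exists_winner_mem_zero {m : ℕ} (hm : 3 ≤ m) {σ₀ : Perm ℕ} (hσ₀ : σ₀ ∈ allPerms m)
    {γ : ℕ → ℕ → ℕ → ℝ} (hγ : GammaMono γ) (ks : List ℕ) (S : Finset ℕ) (hS : S ⊆ range m)
    (hshape : {0, 1, 2} ⊆ S ∨ S = {0, 1} ∨ S = {0})
    (hchain : List.IsChain (· > ·) (S.card :: ks)) (hpos : ∀ k ∈ ks, 1 ≤ k) :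
    ∃ T ∈ msWinners ScoreNorm.l1 γ ks S (σ₀ :: otherVoters m σ₀), 0 ∈ T := by
  induction ks generalizing S with
  | nil =>
    refine ⟨S, rfl, ?_⟩
    rcases hshape with h | rfl | rfl
    · exact h (by simp)
    · simp
    · simp
  | cons k ks ih =>
    rw [List.isChain_cons_cons] at hchain
    obtain ⟨hk, hchain⟩ := hchain
    have hk1 : 1 ≤ k := hpos k (by simp)
    have hpos' : ∀ k ∈ ks, 1 ≤ k := fun k' h => hpos k' (by simp [h])
    suffices ∃ T ∈ scoreWinners ScoreNorm.l1 γ S (σ₀ :: otherVoters m σ₀) k,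
        {0, 1, 2} ⊆ T ∨ T = {0, 1} ∨ T = {0} by
      obtain ⟨T, hT, hshape'⟩ := this
      obtain ⟨U, hU, h0⟩ := ih T (hT.1.trans hS) hshape' (by rwa [hT.2.1]) hpos'
      exact ⟨U, ⟨T, hT, hU⟩, h0⟩
    rcases hshape with h | rfl | rfl
    · have h0 : 0 ∈ S := h (by simp)
      have h1 : 1 ∈ S := h (by simp)
      have h2 : 2 ∈ S := h (by simp)
      have tied : ∀ e ∈ S, candScore γ S (σ₀ :: otherVoters m σ₀) k e =
          permScore (allPerms m) (γ S.card k) S 0 +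
            permScore (allPerms m) (γ S.card k) S 0 / 2 := by
        intro e he
        rw [candScore_profile hσ₀, permScore_cyc_tied hm hS h0 h1 h2 _ he,
          permScore_allPerms_eq hS _ he h0]
      rcases (by omega : k = 1 ∨ k = 2 ∨ 3 ≤ k) with rfl | rfl | hk3
      · exact ⟨{0}, mem_scoreWinners_of_tied tied (by simpa using h0) (by simp), by simp⟩
      · exact ⟨{0, 1}, mem_scoreWinners_of_tied tied (by simp [Finset.insert_subset_iff, h0, h1])
          (by simp), by simp⟩
      · obtain ⟨T, hT, hTS, hTk⟩ := Finset.exists_subsuperset_card_eq h (by simpa using hk3) hk.le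
        exact ⟨T, mem_scoreWinners_of_tied tied hTS hTk, Or.inl hT⟩
    · obtain rfl : k = 1 := by simp at hk; omega
      refine ⟨{0}, singleton_mem_scoreWinners (by simp) fun e he => ?_, by simp⟩
      rw [candScore_profile hσ₀, candScore_profile hσ₀,
        permScore_allPerms_eq hS _ he (by simp : 0 ∈ ({0, 1} : Finset ℕ))]
      refine add_le_add_right ?_ _
      rcases (by simpa using he : e = 0 ∨ e = 1) with rfl | rfl
      · exact le_rfl
      · exact permScore_cyc_pair hm _ (hγ _ _ 1 2 (by omega) (by omega) (by simp))
    · simp at hk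
      omega

/-- Exchanging two adjacent candidates is invisible once one of them has been removed. -/
lemma posIn_shiftForward_erase {v : ℕ → ℕ} {C : Finset ℕ} (hv : Function.Injective v) {c d : ℕ}
    (hcd : v c = v d + 1) {e : ℕ} (he : e ≠ d) :
    posIn (shiftForward v c d) (C.erase d) e = posIn v (C.erase d) e := by
  refine congrArg Finset.card (Finset.filter_congr fun x hx => ?_)
  have hxd := hv.ne (Finset.ne_of_mem_erase hx)
  have hed := hv.ne he
  have hxd' := Finset.ne_of_mem_erase hx
  unfold shiftForward
  split_ifs <;> grind

lemma posIn_shiftForward_self {v : ℕ → ℕ} {C : Finset ℕ} {c d : ℕ} (hc : c ∈ C) (hd : d ∈ C)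
    (hne : d ≠ c) : posIn (shiftForward v c d) C d = posIn v C c := by
  have hS := swap_apply_mem_iff (S := C) (a := c) (b := d) (by simp [hc, hd])
  refine Finset.card_equiv (swap c d) fun x => ?_
  rw [mem_filter, mem_filter, hS, swap_apply_def]
  unfold shiftForward
  split_ifs <;> simp_all

lemma posIn_shiftForward_of_ne {v : ℕ → ℕ} {C : Finset ℕ} {c d e : ℕ} (hc : c ∈ C) (hd : d ∈ C)
    (hec : e ≠ c) (hed : e ≠ d) : posIn (shiftForward v c d) C e = posIn v C e := by
  have hS := swap_apply_mem_iff (S := C) (a := c) (b := d) (by simp [hc, hd])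
  refine Finset.card_equiv (swap c d) fun x => ?_
  rw [mem_filter, mem_filter, hS, swap_apply_def]
  unfold shiftForward
  split_ifs <;> simp_all

lemma posIn_shiftForward_left {v : ℕ → ℕ} {C : Finset ℕ} {c d : ℕ} (hc : c ∈ C) (hd : d ∈ C) :
    posIn (shiftForward v c d) C c = posIn v C d := by
  have hS := swap_apply_mem_iff (S := C) (a := c) (b := d) (by simp [hc, hd])
  refine Finset.card_equiv (swap c d) fun x => ?_
  rw [mem_filter, mem_filter, hS, swap_apply_def]
  unfold shiftForward
  split_ifs <;> simp_all

end MonotonicityCounterexample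

/-- Let `t ≥ 2`, let `γ⃗` be a rational non-increasing family of
position score functions for `β = ℓ₁`, and let `ks = (k_1, …, k_{t-1}, k_t)` be a
stage vector with `k_1 > … > k_t ≥ 1` and `k_t = k_{t-1} − 1` (i.e. `ks` ends
with `a+1, a`).  Then there exist an election `E = (C,V)` with `|C| = k_1 + 1`
candidates, a candidate `c` belonging to some committee in the `t`-stage
`(ℓ₁, γ⃗)`-rule's output, and a voter such that after shifting `c` one position
forward in that voter's preference list, `c` belongs to no winning committee. -/
theorem multistage_l1_candidate_monotonicity_counterexample
    (t : ℕ) (ht : 2 ≤ t) (γ : ℕ → ℕ → ℕ → ℝ) (hγ : GammaMono γ)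
    (hrat : ∀ m k : ℕ, 1 ≤ k → k < m → γ m k m < γ m k 1)
    (kpre : List ℕ) (a : ℕ) (ha : 1 ≤ a) (ks : List ℕ)
    (hks : ks = kpre ++ [a + 1, a]) (hlen : ks.length = t)
    (hchain : List.Chain' (· > ·) ks) :
    ∃ (C : Finset ℕ) (V : List (ℕ → ℕ)),
      StrictPrefs C V ∧ (∀ h : ks ≠ [], C.card = ks.head h + 1) ∧ ValidVec C ks ∧
      ∃ c ∈ C,
        (∃ S ∈ msWinners ScoreNorm.l1 γ ks C V, c ∈ S) ∧
        ∃ (i : ℕ) (hi : i < V.length) (d : ℕ), d ∈ C ∧ d ≠ c ∧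
          posIn (V.get ⟨i, hi⟩) C c = posIn (V.get ⟨i, hi⟩) C d + 1 ∧
          ∀ S' ∈ msWinners ScoreNorm.l1 γ ks C
              (V.set i (shiftForward (V.get ⟨i, hi⟩) c d)), c ∉ S' := by
  obtain ⟨k₁, k₂, rest, rfl⟩ : ∃ k₁ k₂ rest, ks = k₁ :: k₂ :: rest := by
    match ks, hlen with
    | k₁ :: k₂ :: rest, _ => exact ⟨k₁, k₂, rest, rfl⟩
    | [_], h => simp at h; omega
    | [], h => simp at h; omega
  have hpos : ∀ k ∈ k₁ :: k₂ :: rest, 1 ≤ k := by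
    intro k hk
    have hpw := List.isChain_iff_pairwise.1 hchain
    rw [hks] at hpw hk
    rcases List.mem_append.1 hk with h | h
    · have := (List.pairwise_append.1 hpw).2.2 k h a (by simp)
      omega
    · simp at h
      omega
  have h21 : k₂ < k₁ := (List.isChain_cons_cons.1 hchain).1
  have hk₁ : 1 ≤ k₁ := hpos k₁ (by simp)
  have hk₂ : 1 ≤ k₂ := hpos k₂ (by simp)
  obtain ⟨p, hp1, hpm, hp⟩ := exists_strict_drop (n := k₁ + 1) (by omega)
    (hrat (k₁ + 1) k₁ hk₁ (by omega))
  obtain ⟨m, hm⟩ : ∃ m, m = k₁ + 1 := ⟨_, rfl⟩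
  rw [← hm] at hp hpm
  obtain ⟨σ₀, hσ₀, hr0, hr1⟩ : ∃ σ ∈ allPerms m, σ 0 = p ∧ σ 1 = p - 1 := by
    obtain ⟨r, hr, hrp, hrp'⟩ : ∃ r < m, r ≠ p ∧ r ≠ p - 1 := by
      rcases (by omega : p = 1 ∨ 2 ≤ p) with rfl | h
      · exact ⟨2, by omega, by omega, by omega⟩
      · exact ⟨0, by omega, by omega, by omega⟩
    obtain ⟨σ, hσ, h0, h1, -⟩ := exists_perm_three (m := m) (a := 0) (b := 1) (c := 2)
      (ra := p) (rb := p - 1) (rc := r) (by omega) (by omega) (by omega) (by omega)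
      (by omega) hr (by omega) (by omega) (by omega) (by omega) hrp.symm hrp'.symm
    exact ⟨σ, hσ, h0, h1⟩
  have hm3 : 3 ≤ m := by omega
  have m0 : 0 ∈ Finset.range m := Finset.mem_range.2 (by omega)
  have m1 : 1 ∈ Finset.range m := Finset.mem_range.2 (by omega)
  have m2 : 2 ∈ Finset.range m := Finset.mem_range.2 (by omega)
  have hvalid : List.IsChain (· > ·) ((Finset.range m).card :: k₁ :: k₂ :: rest) := by
    rw [Finset.card_range]
    exact List.isChain_cons_cons.2 ⟨by omega, hchain⟩
  have hpos0 : posIn σ₀ (Finset.range m) 0 = p + 1 := by rw [posIn_range hσ₀ (by omega), hr0]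
  have hpos1 : posIn σ₀ (Finset.range m) 1 = p := by
    rw [posIn_range hσ₀ (by omega), hr1]
    omega
  refine ⟨Finset.range m, ⇑σ₀ :: otherVoters m σ₀, ?_, fun _ => by simp [hm], ⟨hvalid, hpos⟩, 0, m0,
    exists_winner_mem_zero hm3 hσ₀ hγ _ _ subset_rfl ?_ hvalid hpos, 0, by simp, 1, m1, by omega,
    ?_, ?_⟩
  · intro v hv
    obtain ⟨σ, rfl⟩ : ∃ σ : Equiv.Perm ℕ, v = σ := by
      rcases List.mem_cons.1 hv with h | h
      · exact ⟨σ₀, h⟩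
      · obtain ⟨σ, -, h⟩ := List.mem_map.1 h
        exact ⟨σ, h.symm⟩
    exact σ.injective.injOn
  · left
    simp [Finset.insert_subset_iff]
    omega
  · exact hpos0.trans (by rw [← hpos1]; rfl)
  · rintro S' ⟨S₁, hS₁, S₂, hS₂, hS'⟩ h0
    change S₁ ∈ scoreWinners _ _ _ (shiftForward σ₀ 0 1 :: otherVoters m σ₀) _ at hS₁
    change S₂ ∈ scoreWinners _ _ _ (shiftForward σ₀ 0 1 :: otherVoters m σ₀) _ at hS₂
    have hshift (S : Finset ℕ) (k e : ℕ) :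
        candScore γ S (shiftForward σ₀ 0 1 :: otherVoters m σ₀) k e =
          candScore γ S (σ₀ :: otherVoters m σ₀) k e - γ S.card k (posIn σ₀ S e) +
            γ S.card k (posIn (shiftForward σ₀ 0 1) S e) := by
      simp only [candScore, List.map_cons, List.sum_cons]
      ring
    have tied : ∀ e ∈ Finset.range m, candScore γ (Finset.range m) (σ₀ :: otherVoters m σ₀) k₁ e =
        candScore γ (Finset.range m) (σ₀ :: otherVoters m σ₀) k₁ 1 := by
      intro e he
      rw [candScore_profile hσ₀, candScore_profile hσ₀,
        permScore_cyc_tied hm3 subset_rfl m0 m1 m2 _ he,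
        permScore_cyc_tied hm3 subset_rfl m0 m1 m2 _ m1,
        permScore_allPerms_eq subset_rfl _ he m1]
    have h1 : 1 ∉ S₁ := by
      refine notMem_of_unique_worst (by simp; omega) (fun e he hne => ?_) hS₁
      rw [hshift, hshift, tied e he, posIn_shiftForward_self m0 m1 (by omega), hpos0, hpos1,
        Finset.card_range]
      by_cases he0 : e = 0
      · rw [he0, posIn_shiftForward_left m0 m1, hpos0, hpos1]
        linarith
      · rw [posIn_shiftForward_of_ne m0 m1 he0 hne]
        linarith
    obtain rfl : S₁ = (Finset.range m).erase 1 := by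
      refine Finset.eq_of_subset_of_card_le (Finset.subset_erase.2 ⟨hS₁.1, h1⟩) ?_
      rw [hS₁.2.1, Finset.card_erase_of_mem m1, Finset.card_range]
      omega
    have hcard : ((Finset.range m).erase 1).card = m - 1 := by
      rw [Finset.card_erase_of_mem m1, Finset.card_range]
    have hsame : ∀ e ≠ 1, candScore γ ((Finset.range m).erase 1)
        (shiftForward σ₀ 0 1 :: otherVoters m σ₀) k₂ e =
          candScore γ ((Finset.range m).erase 1) (σ₀ :: otherVoters m σ₀) k₂ e := by
      intro e he
      rw [hshift, posIn_shiftForward_erase σ₀.injective (by omega) he]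
      ring
    refine notMem_of_unique_worst (by omega) (fun e he hne => ?_) hS₂
      (subset_of_mem_msWinners rest hS' h0)
    rw [hsame 0 (by omega), hsame e (Finset.ne_of_mem_erase he), candScore_profile hσ₀,
      candScore_profile hσ₀, permScore_allPerms_eq (Finset.erase_subset 1 _) _ he
        (Finset.mem_erase.2 ⟨by omega, m0⟩), hcard]
    have := permScore_cyc_unique_worst hm3 (f := γ (m - 1) k₂)
      (fun q hq hqm => hγ _ _ _ _ hq (by omega) hqm) (hrat _ _ hk₂ (by omega)) he hne
    linarith
end

section
/- Let t ≥ 2 and let 𝓡 be the t-stage ω-Thiele rule, where the single-stage ω-Thiele rule satisfies candidate monotonicity, ω(i) is a rational number for every integer i ≥ 0, and there exists an integer i_0 ≥ 2 such that 0 ≠ ω(i_0−1) − ω(i_0−2) ≠ ω(i_0) − ω(i_0−1). Then 𝓡 is not candidate monotone: there exist an election E = (C,V), a stage vector v⃗, a candidate c in some committee of 𝓡(E,v⃗), and a voter such that, after that voter additionally approves c (yielding election E'), c belongs to no committee in 𝓡(E', v⃗). -/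
/-- The ω-Thiele score of a committee `S`, given voters identified with their
approval ballots: `Σ_{v ∈ V} ω(|S ∩ A_v|)`. -/
noncomputable def thieleScore {α : Type} [DecidableEq α] (ω : ℕ → ℝ)
    (V : List (Finset α)) (S : Finset α) : ℝ :=
  (V.map fun A => ω (S ∩ A).card).sum

/-- Winning committees of the single-stage ω-Thiele rule on the candidate pool
`C` with target size `k`: all size-`k` committees maximizing the ω-Thiele score. -/
def thieleWinners {α : Type} [DecidableEq α] (ω : ℕ → ℝ)
    (C : Finset α) (V : List (Finset α)) (k : ℕ) : Set (Finset α) :=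
  {S | S ⊆ C ∧ S.card = k ∧
    ∀ T ⊆ C, T.card = k → thieleScore ω V T ≤ thieleScore ω V S}

/-- Winning committees of the multi-stage ω-Thiele rule for stage vector `ks`,
applying the same ω-Thiele method with the same approval ballots at every stage:
the winning committee of each stage is the candidate pool of the next stage. -/
def msThiele {α : Type} [DecidableEq α] (ω : ℕ → ℝ) :
    List ℕ → Finset α → List (Finset α) → Set (Finset α)
  | [], C, _ => {C}
  | k :: ks, C, V => {S | ∃ S₁ ∈ thieleWinners ω C V k, S ∈ msThiele ω ks S₁ V}

/-- Candidate Monotonicity of the single-stage ω-Thiele rule: whenever `c` is in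
some winning committee and one voter additionally approves `c`, `c` is still in
some winning committee. -/
def ThieleCandidateMonotone (ω : ℕ → ℝ) : Prop :=
  ∀ (α : Type) [DecidableEq α] (C : Finset α) (V : List (Finset α)),
    (∀ A ∈ V, A ⊆ C) →
    ∀ k : ℕ, 1 ≤ k → k < C.card →
    ∀ c ∈ C, (∃ S ∈ thieleWinners ω C V k, c ∈ S) →
    ∀ (i : ℕ) (hi : i < V.length), c ∉ V.get ⟨i, hi⟩ →
      ∃ S' ∈ thieleWinners ω C (V.set i (insert c (V.get ⟨i, hi⟩))) k, c ∈ S'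

/-- Candidate Monotonicity of the `t`-stage ω-Thiele rule. -/
def MSThieleCandidateMonotone (ω : ℕ → ℝ) (t : ℕ) : Prop :=
  ∀ (α : Type) [DecidableEq α] (C : Finset α) (V : List (Finset α)),
    (∀ A ∈ V, A ⊆ C) →
    ∀ (ks : List ℕ), ks ≠ [] → ks.length = t →
      List.Chain (· > ·) C.card ks → (∀ k ∈ ks, 1 ≤ k) →
    ∀ c ∈ C, (∃ S ∈ msThiele ω ks C V, c ∈ S) →
    ∀ (i : ℕ) (hi : i < V.length), c ∉ V.get ⟨i, hi⟩ →
      ∃ S' ∈ msThiele ω ks C (V.set i (insert c (V.get ⟨i, hi⟩))), c ∈ S'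

/-- The stage vector `n + r - 1, …, n + 1, n` followed by `ks`. -/
def descendingStages (n : ℕ) (ks : List ℕ) : ℕ → List ℕ
  | 0 => ks
  | r + 1 => (n + r) :: descendingStages n ks r

theorem length_descendingStages (n : ℕ) (ks : List ℕ) (r : ℕ) :
    (descendingStages n ks r).length = ks.length + r := by
  induction r with
  | zero => rfl
  | succ r ih => simp [descendingStages, ih, add_assoc]

theorem isChain_descendingStages {n : ℕ} {ks : List ℕ}
    (h : List.IsChain (· > ·) (n :: ks)) (r : ℕ) :
    List.IsChain (· > ·) ((n + r) :: descendingStages n ks r) := by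
  induction r with
  | zero => simpa [descendingStages] using h
  | succ r ih => exact List.IsChain.cons_cons (by omega) ih

theorem one_le_of_mem_descendingStages {n : ℕ} {ks : List ℕ} (hn : 1 ≤ n)
    (h : ∀ k ∈ ks, 1 ≤ k) (r : ℕ) : ∀ k ∈ descendingStages n ks r, 1 ≤ k := by
  induction r with
  | zero => exact h
  | succ r ih =>
    intro k hk
    rcases List.mem_cons.1 hk with rfl | hk
    · omega
    · exact ih k hk

theorem thieleScore_cons {α : Type} [DecidableEq α] (ω : ℕ → ℝ) (A : Finset α)
    (V : List (Finset α)) (S : Finset α) :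
    thieleScore ω (A :: V) S = ω (S ∩ A).card + thieleScore ω V S := by
  simp [thieleScore]

theorem thieleScore_append {α : Type} [DecidableEq α] (ω : ℕ → ℝ)
    (V W : List (Finset α)) (S : Finset α) :
    thieleScore ω (V ++ W) S = thieleScore ω V S + thieleScore ω W S := by
  simp [thieleScore]

theorem thieleScore_replicate {α : Type} [DecidableEq α] (ω : ℕ → ℝ) (n : ℕ)
    (A S : Finset α) :
    thieleScore ω (List.replicate n A) S = n * ω (S ∩ A).card := by
  simp [thieleScore]

/-- Candidates approved by nobody do not contribute to the score. -/
theorem thieleScore_eq_of_subset {α : Type} [DecidableEq α] (ω : ℕ → ℝ)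
    {V : List (Finset α)} {B S : Finset α} (hV : ∀ A ∈ V, A ⊆ B) (hS : B ⊆ S) :
    thieleScore ω V S = thieleScore ω V B := by
  unfold thieleScore
  congr 1
  refine List.map_congr_left fun A hA => ?_
  rw [Finset.inter_eq_right.2 (hV A hA), Finset.inter_eq_right.2 ((hV A hA).trans hS)]

/-- If each candidate of `B` is approved on a ballot of size `p + 1`, at which `ω` strictly
increases, then a committee not containing `B` scores strictly less than `B`. -/
theorem thieleScore_lt_of_not_subset {α : Type} [DecidableEq α] {ω : ℕ → ℝ}
    (hmono : Monotone ω) {p : ℕ} (hp : ω p < ω (p + 1))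
    {V : List (Finset α)} {B S : Finset α} (hV : ∀ A ∈ V, A ⊆ B)
    (hB : ∀ z ∈ B, ∃ A ∈ V, z ∈ A ∧ A.card = p + 1) (hS : ¬ B ⊆ S) :
    thieleScore ω V S < thieleScore ω V B := by
  obtain ⟨z, hzB, hzS⟩ := Finset.not_subset.1 hS
  obtain ⟨A, hA, hzA, hcard⟩ := hB z hzB
  refine List.sum_lt_sum _ _ (fun A hA => hmono ?_) ⟨A, hA, ?_⟩
  · rw [Finset.inter_eq_right.2 (hV A hA)]
    exact Finset.card_le_card Finset.inter_subset_right
  · rw [Finset.inter_eq_right.2 (hV A hA), hcard]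
    refine lt_of_le_of_lt (hmono ?_) hp
    have : (S ∩ A).card < A.card := Finset.card_lt_card
      ⟨Finset.inter_subset_right, fun h => hzS (Finset.mem_inter.1 (h hzA)).1⟩
    omega

/-- Preliminary stages eliminate precisely the candidates outside `B`. -/
theorem msThiele_descendingStages {α : Type} [DecidableEq α] (ω : ℕ → ℝ)
    {V : List (Finset α)} {B : Finset α} (hV : ∀ A ∈ V, A ⊆ B)
    (hB : ∀ S, ¬ B ⊆ S → thieleScore ω V S < thieleScore ω V B) (ks : List ℕ) (r : ℕ) :
    ∀ C, B ⊆ C → C.card = B.card + r →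
      msThiele ω (descendingStages B.card ks r) C V = msThiele ω ks B V := by
  induction r with
  | zero =>
    intro C hC hcard
    rw [Finset.eq_of_subset_of_card_le hC hcard.le]
    rfl
  | succ r ih =>
    intro C hC hcard
    obtain ⟨T, hBT, hTC, hT⟩ := Finset.exists_subsuperset_card_eq (n := B.card + r) hC
      (by omega) (by omega)
    ext S
    constructor
    · rintro ⟨S₁, ⟨-, hcard₁, hmax⟩, hS⟩
      have hBS : B ⊆ S₁ := by
        by_contra h
        have := hmax T hTC hT
        rw [thieleScore_eq_of_subset ω hV hBT] at this
        exact absurd (hB S₁ h) this.not_gt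
      rwa [ih S₁ hBS hcard₁] at hS
    · intro hS
      refine ⟨T, ⟨hTC, hT, fun U _ _ => ?_⟩, by rwa [ih T hBT hT]⟩
      rw [thieleScore_eq_of_subset ω hV hBT]
      by_cases h : B ⊆ U
      · rw [thieleScore_eq_of_subset ω hV h]
      · exact (hB U h).le

/-- Winning committees when a single candidate is eliminated. -/
theorem mem_thieleWinners_iff_erase {α : Type} [DecidableEq α] (ω : ℕ → ℝ)
    {V : List (Finset α)} {C S : Finset α} {k : ℕ} (hC : C.card = k + 1) :
    S ∈ thieleWinners ω C V k ↔ ∃ z ∈ C, S = C.erase z ∧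
      ∀ w ∈ C, thieleScore ω V (C.erase w) ≤ thieleScore ω V (C.erase z) := by
  have key : ∀ T ⊆ C, T.card = k → ∃ z ∈ C, T = C.erase z := by
    intro T hT hcard
    have h1 : (C \ T).card = 1 := by rw [Finset.card_sdiff_of_subset hT]; omega
    obtain ⟨z, hz⟩ := Finset.card_eq_one.1 h1
    have hzm : z ∈ C \ T := by simp [hz]
    refine ⟨z, (Finset.mem_sdiff.1 hzm).1, ?_⟩
    rw [← Finset.sdiff_singleton_eq_erase, ← hz, Finset.sdiff_sdiff_eq_self hT]
  have hk : ∀ w ∈ C, (C.erase w).card = k := fun w hw => by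
    rw [Finset.card_erase_of_mem hw]; omega
  constructor
  · rintro ⟨hS, hcard, hmax⟩
    obtain ⟨z, hz, rfl⟩ := key S hS hcard
    exact ⟨z, hz, rfl, fun w hw => hmax _ (Finset.erase_subset _ _) (hk w hw)⟩
  · rintro ⟨z, hz, rfl, hmax⟩
    refine ⟨Finset.erase_subset _ _, hk z hz, fun T hT hcard => ?_⟩
    obtain ⟨w, hw, rfl⟩ := key T hT hcard
    exact hmax w hw

/-- A winning chain `B ⊇ B \ {v} ⊇ B \ {v, w}` containing `0` before the change, and a unique
winning chain `B ⊇ B \ {u} ⊇ B \ {u, 0}` after it, refute candidate monotonicity. -/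
theorem not_msThieleCandidateMonotone_of_chains {ω : ℕ → ℝ} (hmono : Monotone ω) {p : ℕ}
    (hp : ω p < ω (p + 1)) {A : Finset ℕ} {V : List (Finset ℕ)} (h0A : 0 ∉ A)
    (hA : A ⊆ Finset.range (p + 3)) (hV : ∀ A ∈ V, A ⊆ Finset.range (p + 3))
    (hB : ∀ z ∈ Finset.range (p + 3), ∃ A ∈ V, z ∈ A ∧ A.card = p + 1) {v w u : ℕ}
    (hv : v ∈ Finset.range (p + 3)) (hw : w ∈ (Finset.range (p + 3)).erase v)
    (hu : u ∈ Finset.range (p + 3)) (hv0 : v ≠ 0) (hw0 : w ≠ 0) (hu0 : u ≠ 0)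
    (hv_max : ∀ z ∈ Finset.range (p + 3),
      thieleScore ω (A :: V) ((Finset.range (p + 3)).erase z) ≤
        thieleScore ω (A :: V) ((Finset.range (p + 3)).erase v))
    (hw_max : ∀ z ∈ (Finset.range (p + 3)).erase v,
      thieleScore ω (A :: V) (((Finset.range (p + 3)).erase v).erase z) ≤
        thieleScore ω (A :: V) (((Finset.range (p + 3)).erase v).erase w))
    (hu_max : ∀ z ∈ Finset.range (p + 3), z ≠ u →
      thieleScore ω (insert 0 A :: V) ((Finset.range (p + 3)).erase z) <
        thieleScore ω (insert 0 A :: V) ((Finset.range (p + 3)).erase u))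
    (h0_max : ∀ z ∈ (Finset.range (p + 3)).erase u, z ≠ 0 →
      thieleScore ω (insert 0 A :: V) (((Finset.range (p + 3)).erase u).erase z) <
        thieleScore ω (insert 0 A :: V) (((Finset.range (p + 3)).erase u).erase 0))
    {t : ℕ} (ht : 2 ≤ t) : ¬ MSThieleCandidateMonotone ω t := by
  intro hms
  obtain ⟨r, rfl⟩ := Nat.exists_eq_add_of_le ht
  set B := Finset.range (p + 3) with hBdef
  have hBcard : B.card = p + 3 := Finset.card_range _
  have hBC : B ⊆ Finset.range (p + 3 + r) := Finset.range_mono (by omega)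
  have h0B : 0 ∈ B := by simp [hBdef]
  have hVA : ∀ A' ∈ A :: V, A' ⊆ B := List.forall_mem_cons.2 ⟨hA, hV⟩
  have reduce : ∀ A', A' ⊆ B → msThiele ω (descendingStages B.card [p + 2, p + 1] r)
      (Finset.range (p + 3 + r)) (A' :: V) = msThiele ω [p + 2, p + 1] B (A' :: V) := by
    intro A' hA'
    have hV' : ∀ A ∈ A' :: V, A ⊆ B := List.forall_mem_cons.2 ⟨hA', hV⟩
    refine msThiele_descendingStages ω hV' (fun S hS =>
      thieleScore_lt_of_not_subset hmono hp hV' (fun z hz => ?_) hS) _ r _ hBC (by simp [hBcard])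
    obtain ⟨A, hA, h⟩ := hB z hz
    exact ⟨A, List.mem_cons_of_mem _ hA, h⟩
  have hcard_erase : ∀ z ∈ B, (B.erase z).card = p + 1 + 1 := fun z hz => by
    rw [Finset.card_erase_of_mem hz, hBcard]; rfl
  obtain ⟨S, hS, h0S⟩ := hms ℕ (Finset.range (p + 3 + r)) (A :: V)
    (fun A' hA' => (hVA A' hA').trans hBC)
    (descendingStages B.card [p + 2, p + 1] r)
    (by rw [← List.length_pos_iff, length_descendingStages]; simp)
    (by rw [length_descendingStages]; simp)
    (by
      have := isChain_descendingStages (n := B.card) (ks := [p + 2, p + 1]) (by simp [hBcard]) r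
      rw [Finset.card_range]
      rwa [hBcard] at this ⊢)
    (one_le_of_mem_descendingStages (by omega) (by simp) r) 0 (hBC h0B)
    (by
      rw [reduce A hA]
      refine ⟨(B.erase v).erase w, ⟨B.erase v, ?_, (B.erase v).erase w, ?_, rfl⟩, ?_⟩
      · exact (mem_thieleWinners_iff_erase ω hBcard).2 ⟨v, hv, rfl, hv_max⟩
      · exact (mem_thieleWinners_iff_erase ω (hcard_erase v hv)).2 ⟨w, hw, rfl, hw_max⟩
      · simp [hv0.symm, hw0.symm, h0B])
    0 (by simp) h0A
  have hset : (A :: V).set 0 (insert 0 ((A :: V).get ⟨0, by simp⟩)) = insert 0 A :: V := rfl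
  rw [hset, reduce _ (Finset.insert_subset h0B hA)] at hS
  obtain ⟨S₁, hS₁, S₂, hS₂, rfl⟩ := hS
  obtain ⟨z, hz, rfl, hmax⟩ := (mem_thieleWinners_iff_erase ω hBcard).1 hS₁
  obtain rfl : z = u := by
    by_contra hne
    exact absurd (hu_max z hz hne) (hmax u hu).not_gt
  obtain ⟨w', hw', rfl, hmax'⟩ := (mem_thieleWinners_iff_erase ω (hcard_erase z hz)).1 hS₂
  obtain rfl : w' = 0 := by
    by_contra hne
    exact absurd (h0_max w' hw' hne)
      (hmax' 0 (Finset.mem_erase.2 ⟨hu0.symm, h0B⟩)).not_gt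
  simp at h0S

/-- The ballot approving the `p` common candidates `3, …, p + 2` and those in `K`. -/
def coreBallot (p : ℕ) (K : Finset ℕ) : Finset ℕ :=
  K ∪ Finset.Ico 3 (p + 3)

theorem insert_coreBallot (p : ℕ) (c : ℕ) (K : Finset ℕ) :
    insert c (coreBallot p K) = coreBallot p (insert c K) := by
  simp [coreBallot, Finset.insert_union]

theorem coreBallot_subset_range {p : ℕ} {K : Finset ℕ} (hK : K ⊆ Finset.range 3) :
    coreBallot p K ⊆ Finset.range (p + 3) := by
  intro z hz
  rcases Finset.mem_union.1 hz with h | h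
  · have := Finset.mem_range.1 (hK h)
    simp; omega
  · simp at h ⊢; omega

theorem card_coreBallot {p : ℕ} {K : Finset ℕ} (hK : K ⊆ Finset.range 3) :
    (coreBallot p K).card = K.card + p := by
  rw [coreBallot, Finset.card_union_of_disjoint, Nat.card_Ico, Nat.add_sub_cancel]
  refine Finset.disjoint_left.2 fun z hz hz' => ?_
  have h1 := Finset.mem_range.1 (hK hz)
  have h2 := Finset.mem_Ico.1 hz'
  omega

theorem range_inter_coreBallot {p : ℕ} {K : Finset ℕ} (hK : K ⊆ Finset.range 3) :
    Finset.range (p + 3) ∩ coreBallot p K = coreBallot p K :=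
  Finset.inter_eq_right.2 (coreBallot_subset_range hK)

theorem erase_coreBallot {p z : ℕ} (hz : z < 3) (K : Finset ℕ) :
    (coreBallot p K).erase z = coreBallot p (K.erase z) := by
  rw [coreBallot, Finset.erase_union_distrib, coreBallot,
    Finset.erase_eq_of_notMem (s := Finset.Ico _ _) (by simp; omega)]

theorem card_erase_coreBallot {p q z : ℕ} (hp : p = q + 1) (hz : 3 ≤ z) (hzp : z < p + 3)
    {K : Finset ℕ} (hK : K ⊆ Finset.range 3) :
    ((coreBallot p K).erase z).card = K.card + q := by
  have hmem : z ∈ coreBallot p K := Finset.mem_union_right _ (Finset.mem_Ico.2 ⟨hz, hzp⟩)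
  rw [Finset.card_erase_of_mem hmem, card_coreBallot hK]
  omega

/-- Voters approving the common candidates together with one or two of `0`, `1`, `2`, with the
given multiplicities. -/
def coreProfile (p n₀ n₁ n₂ n₀₁ n₀₂ n₁₂ : ℕ) : List (Finset ℕ) :=
  List.replicate n₀ (coreBallot p {0}) ++ List.replicate n₁ (coreBallot p {1}) ++
    List.replicate n₂ (coreBallot p {2}) ++ List.replicate n₀₁ (coreBallot p {0, 1}) ++
    List.replicate n₀₂ (coreBallot p {0, 2}) ++ List.replicate n₁₂ (coreBallot p {1, 2})

theorem subset_range_of_mem_coreProfile {p n₀ n₁ n₂ n₀₁ n₀₂ n₁₂ : ℕ} :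
    ∀ A ∈ coreProfile p n₀ n₁ n₂ n₀₁ n₀₂ n₁₂, A ⊆ Finset.range (p + 3) := by
  intro A hA
  simp only [coreProfile, List.mem_append, List.mem_replicate] at hA
  rcases hA with ((((⟨-, rfl⟩ | ⟨-, rfl⟩) | ⟨-, rfl⟩) | ⟨-, rfl⟩) | ⟨-, rfl⟩) | ⟨-, rfl⟩ <;>
    exact coreBallot_subset_range (by decide)

theorem exists_mem_coreProfile {p n₀ n₁ n₂ : ℕ} (n₀₁ n₀₂ n₁₂ : ℕ) (h₀ : n₀ ≠ 0) (h₁ : n₁ ≠ 0)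
    (h₂ : n₂ ≠ 0) : ∀ z ∈ Finset.range (p + 3),
      ∃ A ∈ coreProfile p n₀ n₁ n₂ n₀₁ n₀₂ n₁₂, z ∈ A ∧ A.card = p + 1 := by
  intro z hz
  have hcard : ∀ y < 3, (coreBallot p {y}).card = p + 1 := fun y hy => by
    rw [card_coreBallot (by simpa using hy), Finset.card_singleton, add_comm]
  rw [Finset.mem_range] at hz
  by_cases hz1 : z = 1
  · exact ⟨coreBallot p {1}, by simp [coreProfile, h₁], by simp [coreBallot, hz1],
      hcard 1 (by omega)⟩
  by_cases hz2 : z = 2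
  · exact ⟨coreBallot p {2}, by simp [coreProfile, h₂], by simp [coreBallot, hz2],
      hcard 2 (by omega)⟩
  · exact ⟨coreBallot p {0}, by simp [coreProfile, h₀], by simp [coreBallot]; omega,
      hcard 0 (by omega)⟩

theorem thieleScore_coreProfile (ω : ℕ → ℝ) (p n₀ n₁ n₂ n₀₁ n₀₂ n₁₂ : ℕ) (S : Finset ℕ) :
    thieleScore ω (coreProfile p n₀ n₁ n₂ n₀₁ n₀₂ n₁₂) S =
      n₀ * ω (S ∩ coreBallot p {0}).card + n₁ * ω (S ∩ coreBallot p {1}).card +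
      n₂ * ω (S ∩ coreBallot p {2}).card + n₀₁ * ω (S ∩ coreBallot p {0, 1}).card +
      n₀₂ * ω (S ∩ coreBallot p {0, 2}).card + n₁₂ * ω (S ∩ coreBallot p {1, 2}).card := by
  simp only [coreProfile, thieleScore_append, thieleScore_replicate]

/-- If the increments of `ω` at `p + 1` and `p + 2` differ, the first one is positive, and they are
commensurable, then multistage ω-Thiele rules violate candidate monotonicity. -/
theorem not_msThieleCandidateMonotone_of_commensurable {ω : ℕ → ℝ} (hmono : Monotone ω)
    {p α β : ℕ} (hα : 0 < α) (hβ : 0 < β) {a b : ℝ} (ha : ω (p + 1) = ω p + a)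
    (hb : ω (p + 2) = ω p + a + b) (ha0 : 0 < a) (hab : a ≠ b)
    (hαβ : a * α = |b - a| * β) {t : ℕ} (ht : 2 ≤ t) : ¬ MSThieleCandidateMonotone ω t := by
  have hp : ω p < ω (p + 1) := by linarith
  obtain ⟨w, hw⟩ : ∃ w, ω p = w := ⟨_, rfl⟩
  have hb0 : 0 ≤ b := by have := hmono (show p + 1 ≤ p + 2 by omega); linarith
  have hα1 : (1 : ℝ) ≤ α := by exact_mod_cast hα
  have hβ1 : (1 : ℝ) ≤ β := by exact_mod_cast hβ
  have haα : a ≤ a * α := le_mul_of_one_le_right ha0.le hα1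
  have haβ : a ≤ a * β := le_mul_of_one_le_right ha0.le hβ1
  have hbβ : b ≤ b * β := le_mul_of_one_le_right hb0 hβ1
  have ha' : ω (1 + p) = w + a := by rw [add_comm, ha, hw]
  have hb' : ω (2 + p) = w + a + b := by rw [add_comm, hb, hw]
  have hq : ∀ z ∈ Finset.range (p + 3), z = 0 ∨ z = 1 ∨ z = 2 ∨ (3 ≤ z ∧ z < p + 3 ∧
      ∃ q w', p = q + 1 ∧ ω q = w' ∧ ω (1 + q) = w ∧ ω (2 + q) = w + a ∧ 0 ≤ w - w' ∧
        w - w' ≤ (w - w') * α ∧ w - w' ≤ (w - w') * β) := by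
    intro z hz
    rw [Finset.mem_range] at hz
    by_cases hz3 : z < 3
    · omega
    · refine .inr (.inr (.inr ⟨by omega, hz, p - 1, _, by omega, rfl, ?_, ?_, ?_⟩))
      · rw [← hw]; congr 1; omega
      · rw [← ha']; congr 1; omega
      · have : 0 ≤ w - ω (p - 1) := by
          have := hmono (show p - 1 ≤ p by omega); linarith
        exact ⟨this, le_mul_of_one_le_right this hα1, le_mul_of_one_le_right this hβ1⟩
  rcases hab.lt_or_gt with hlt | hlt
  · rw [abs_of_pos (by linarith)] at hαβ
    refine not_msThieleCandidateMonotone_of_chains (A := coreBallot p {1})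
      (V := coreProfile p 1 (2 * α + 4 * β) (2 * β + 1) (2 * β) (4 * β) 0)
      (v := 1) (w := 2) (u := 2) hmono hp (by simp [coreBallot])
      (coreBallot_subset_range (by decide)) subset_range_of_mem_coreProfile
      (exists_mem_coreProfile _ _ _ (by omega) (by omega) (by omega))
      (by simp) (by simp) (by simp) (by simp) (by simp) (by simp) ?_ ?_ ?_ ?_ ht
    all_goals
      intro z hz
      try intro hne
      rcases hq z (by first | exact hz | exact Finset.mem_of_mem_erase hz) with
        rfl | rfl | rfl | ⟨hz3, hzp, q, w', hpq, hq0, hq1, hq2, hw1, hw2, hw3⟩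
    all_goals
      first
      | exact absurd rfl hne
      | exact absurd hz (Finset.notMem_erase _ _)
      | simp (discharger := decide) only [thieleScore_cons, thieleScore_coreProfile,
          insert_coreBallot, Finset.erase_inter, range_inter_coreBallot, erase_coreBallot,
          card_coreBallot]
        simp (decide := true) [Finset.card_insert_of_notMem, hw, ha', hb'] <;> linarith
      | simp (discharger := decide) only [thieleScore_cons, thieleScore_coreProfile,
          insert_coreBallot, Finset.erase_inter, range_inter_coreBallot, erase_coreBallot,
          card_coreBallot, card_erase_coreBallot hpq hz3 hzp]
        simp (decide := true) [Finset.card_insert_of_notMem, hw, ha', hb', hq0, hq1, hq2] <;>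
          linarith
  · rw [abs_of_neg (by linarith)] at hαβ
    refine not_msThieleCandidateMonotone_of_chains (A := coreBallot p {1})
      (V := coreProfile p (4 * β + 1) (2 * β) (2 * α + 1) 0 (2 * β) (4 * β))
      (v := 2) (w := 1) (u := 1) hmono hp (by simp [coreBallot])
      (coreBallot_subset_range (by decide)) subset_range_of_mem_coreProfile
      (exists_mem_coreProfile _ _ _ (by omega) (by omega) (by omega))
      (by simp) (by simp) (by simp) (by simp) (by simp) (by simp) ?_ ?_ ?_ ?_ ht
    all_goals
      intro z hz
      try intro hne
      rcases hq z (by first | exact hz | exact Finset.mem_of_mem_erase hz) with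
        rfl | rfl | rfl | ⟨hz3, hzp, q, w', hpq, hq0, hq1, hq2, hw1, hw2, hw3⟩
    all_goals
      first
      | exact absurd rfl hne
      | exact absurd hz (Finset.notMem_erase _ _)
      | simp (discharger := decide) only [thieleScore_cons, thieleScore_coreProfile,
          insert_coreBallot, Finset.erase_inter, range_inter_coreBallot, erase_coreBallot,
          card_coreBallot]
        simp (decide := true) [Finset.card_insert_of_notMem, hw, ha', hb'] <;> linarith
      | simp (discharger := decide) only [thieleScore_cons, thieleScore_coreProfile,
          insert_coreBallot, Finset.erase_inter, range_inter_coreBallot, erase_coreBallot,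
          card_coreBallot, card_erase_coreBallot hpq hz3 hzp]
        simp (decide := true) [Finset.card_insert_of_notMem, hw, ha', hb', hq0, hq1, hq2] <;>
          linarith

/-- Let `t ≥ 2` and let `𝓡` be the `t`-stage ω-Thiele rule,
where the single-stage ω-Thiele rule satisfies Candidate Monotonicity, `ω(i)` is
rational for every `i ≥ 0`, and `0 ≠ ω(i₀−1) − ω(i₀−2) ≠ ω(i₀) − ω(i₀−1)` for
some integer `i₀ ≥ 2`.  Then `𝓡` is not candidate monotone. -/
theorem multistage_thiele_not_candidate_monotone
    (t : ℕ) (ht : 2 ≤ t) (ω : ℕ → ℝ)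
    (hmono : Monotone ω) (h0 : ω 0 = 0)
    (hrat : ∀ i : ℕ, ∃ q : ℚ, ω i = (q : ℝ))
    (hcm : ThieleCandidateMonotone ω)
    (hi : ∃ i₀ : ℕ, 2 ≤ i₀ ∧ ω (i₀ - 1) - ω (i₀ - 2) ≠ 0 ∧
      ω (i₀ - 1) - ω (i₀ - 2) ≠ ω i₀ - ω (i₀ - 1)) :
    ¬ MSThieleCandidateMonotone ω t := by
  obtain ⟨i, hi2, hne0, hne⟩ := hi
  obtain ⟨p, rfl⟩ := Nat.exists_eq_add_of_le' hi2
  rw [show p + 2 - 1 = p + 1 by omega, show p + 2 - 2 = p by omega] at hne0 hne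
  have ha0 : 0 < ω (p + 1) - ω p :=
    lt_of_le_of_ne (sub_nonneg.2 (hmono (by omega))) hne0.symm
  obtain ⟨x, hx⟩ := hrat p
  obtain ⟨y, hy⟩ := hrat (p + 1)
  obtain ⟨z, hz⟩ := hrat (p + 2)
  have hyx : 0 < y - x := by rw [hx, hy] at ha0; exact_mod_cast ha0
  have hzy : (z - y) - (y - x) ≠ 0 := by
    intro h
    apply hne
    rw [hx, hy, hz]
    exact_mod_cast (sub_eq_zero.1 h).symm
  have hr : 0 < |(z - y) - (y - x)| / (y - x) := div_pos (abs_pos.2 hzy) hyx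
  obtain ⟨r, hrdef⟩ : ∃ r, r = |(z - y) - (y - x)| / (y - x) := ⟨_, rfl⟩
  rw [← hrdef] at hr
  have hnum : 0 < r.num := Rat.num_pos.2 hr
  have key : (y - x) * r.num.toNat = |(z - y) - (y - x)| * r.den := by
    have h1 : ((r.num.toNat : ℕ) : ℚ) = r.num := by exact_mod_cast Int.toNat_of_nonneg hnum.le
    rw [h1, ← Rat.mul_den_eq_num r, ← mul_assoc]
    congr 1
    rw [hrdef]
    field_simp
  refine not_msThieleCandidateMonotone_of_commensurable hmono (p := p) (α := r.num.toNat)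
    (β := r.den) (by omega) r.den_pos (a := ω (p + 1) - ω p) (b := ω (p + 2) - ω (p + 1))
    (by ring) (by ring) ha0 hne ?_ ht
  rw [hx, hy, hz]
  exact_mod_cast key
end
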